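/- Fix a real path-loss exponent α ≥ 2 and an SIR threshold T > 0. There exist a constant κ > 0 and, for each n, a measurable map χ_n from configurations (x_1,…,x_n) ∈ ([0,1]²)^n to colorings χ : {1,…,n} → {1,…,⌈κ·log n⌉}, such that if X_1,…,X_n are independent and uniformly distributed on the unit square [0,1]², then the probability that the colored SIR digraph of (X_1,…,X_n) with coloring χ_n(X_1,…,X_n) is connected tends to 1 as n → ∞. -/

import Mathlib

open MeasureTheory Filter

noncomputable section

/-- The closed unit square `[0,1]² ⊂ ℝ²`. -/
def unitSquare : Set (EuclideanSpace ℝ (Fin 2)) :=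
  {p | ∀ i, p i ∈ Set.Icc (0 : ℝ) 1}

/-- Edge relation of the colored SIR digraph with power-law attenuation `r ↦ r^{-α}`:
there is an edge from `i` to `j` iff `i ≠ j` and the signal power `‖x_i - x_j‖^{-α}` is at
least `T` times the interference `Σ_{k ≠ i, χ(k) = χ(i)} ‖x_k - x_j‖^{-α}` (real powers). -/
def sirEdge (α T : ℝ) {n : ℕ} (x : Fin n → EuclideanSpace ℝ (Fin 2))
    (χ : Fin n → ℕ) (i j : Fin n) : Prop :=
  i ≠ j ∧
    T * ∑ k ∈ Finset.univ.filter fun k => k ≠ i ∧ χ k = χ i,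
        dist (x k) (x j) ^ (-α) ≤
      dist (x i) (x j) ^ (-α)

/-- The colored SIR digraph is connected: between every ordered pair of distinct vertices
there is a directed path. -/
def sirConnected (α T : ℝ) {n : ℕ} (x : Fin n → EuclideanSpace ℝ (Fin 2))
    (χ : Fin n → ℕ) : Prop :=
  ∀ i j : Fin n, i ≠ j → Relation.TransGen (sirEdge α T x χ) i j

abbrev EE := EuclideanSpace ℝ (Fin 2)

def clv (l : ℕ) (c : ℕ × ℕ) : ℕ × ℕ := (c.1 / 2 ^ l, c.2 / 2 ^ l)

def nearC (k : ℕ) (a b : ℕ × ℕ) : Prop :=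
  a.1 ≤ b.1 + k ∧ b.1 ≤ a.1 + k ∧ a.2 ≤ b.2 + k ∧ b.2 ≤ a.2 + k

def isRep {n : ℕ} (c : Fin n → ℕ × ℕ) (l : ℕ) (i : Fin n) : Prop :=
  ∀ j, clv l (c j) = clv l (c i) → i ≤ j

def needL {n : ℕ} (N : ℕ) (c : Fin n → ℕ × ℕ) (i : Fin n) (l : ℕ) : Prop :=
  l = 0 ∨ (isRep c l i ∧ ∃ e : ℕ × ℕ, e.1 < 2 ^ (N - l) ∧ e.2 < 2 ^ (N - l) ∧
    nearC 3 (clv l (c i)) e ∧ ∀ j, clv l (c j) ≠ e)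

open Classical in
def lam {n : ℕ} (N : ℕ) (c : Fin n → ℕ × ℕ) (i : Fin n) : ℕ :=
  Nat.findGreatest (needL N c i) N

lemma lam_le {n : ℕ} (N : ℕ) (c : Fin n → ℕ × ℕ) (i : Fin n) : lam N c i ≤ N := by
  classical
  exact Nat.findGreatest_le N

lemma le_lam {n : ℕ} (N : ℕ) (c : Fin n → ℕ × ℕ) (i : Fin n) (l : ℕ) (hl : l ≤ N)
    (h : needL N c i l) : l ≤ lam N c i := by
  classical
  exact Nat.le_findGreatest hl h

lemma need_lam {n : ℕ} (N : ℕ) (c : Fin n → ℕ × ℕ) (i : Fin n) :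
    needL N c i (lam N c i) := by
  classical
  exact Nat.findGreatest_spec (P := needL N c i) (Nat.zero_le N) (Or.inl rfl)

lemma exists_rep {n : ℕ} (c : Fin n → ℕ × ℕ) (l : ℕ) (i : Fin n) :
    ∃ p, isRep c l p ∧ clv l (c p) = clv l (c i) := by
  classical
  let S := Finset.univ.filter fun j => clv l (c j) = clv l (c i)
  have hS : S.Nonempty := ⟨i, by simp [S]⟩
  have hm := S.min'_mem hS
  have hm' : clv l (c (S.min' hS)) = clv l (c i) := by
    simpa [S] using hm
  refine ⟨S.min' hS, ?_, hm'⟩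
  intro j hj
  apply Finset.min'_le
  simp [S, hj, hm']

lemma mid1 (a b : ℕ) (h1 : a ≤ b + 3) (h2 : b ≤ a + 3) : ∃ e f : ℕ,
    a ≤ e + 1 ∧ e ≤ a + 1 ∧ e ≤ f + 1 ∧ f ≤ e + 1 ∧ f ≤ b + 1 ∧ b ≤ f + 1 ∧
    a ≤ e + 3 ∧ e ≤ a + 3 ∧ b ≤ e + 3 ∧ e ≤ b + 3 ∧
    a ≤ f + 3 ∧ f ≤ a + 3 ∧ b ≤ f + 3 ∧ f ≤ b + 3 ∧
    (e ≤ a ∨ e ≤ b) ∧ (f ≤ a ∨ f ≤ b) := by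
  rcases lt_trichotomy a b with h | h | h
  · refine ⟨a + 1, min (a + 2) b, ?_⟩
    omega
  · exact ⟨a, a, by omega⟩
  · refine ⟨a - 1, max (a - 2) b, ?_⟩
    omega

lemma div_lt_pow {a N l : ℕ} (hl : l ≤ N) (h : a < 2 ^ N) : a / 2 ^ l < 2 ^ (N - l) := by
  rw [Nat.div_lt_iff_lt_mul (by positivity), ← pow_add, Nat.sub_add_cancel hl]
  exact h

lemma conn_aux {n : ℕ} (N : ℕ) (c : Fin n → ℕ × ℕ)
    (hc : ∀ i, (c i).1 < 2 ^ N ∧ (c i).2 < 2 ^ N)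
    (E : Fin n → Fin n → Prop)
    (hE : ∀ i j l, i ≠ j → l ≤ lam N c i → nearC 3 (clv l (c i)) (clv l (c j)) → E i j)
    (l : ℕ) (hl : l ≤ N) : ∀ u v, nearC 1 (clv l (c u)) (clv l (c v)) →
      Relation.ReflTransGen E u v := by
  induction l with
  | zero =>
    intro u v h
    by_cases huv : u = v
    · rw [huv]
    · apply Relation.ReflTransGen.single
      apply hE u v 0 huv (Nat.zero_le _)
      unfold nearC at *; omega
  | succ l ih =>
    intro u v h
    have ih := ih (by omega)
    have h3 : nearC 3 (clv l (c u)) (clv l (c v)) := by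
      unfold nearC clv at *
      simp only [pow_succ, ← Nat.div_div_eq_div_mul] at h
      simp only
      omega
    by_cases hall : ∀ e : ℕ × ℕ, e.1 < 2 ^ (N - l) → e.2 < 2 ^ (N - l) →
        nearC 3 (clv l (c u)) e → nearC 3 (clv l (c v)) e → ∃ w, clv l (c w) = e
    · have hu1 : (clv l (c u)).1 < 2 ^ (N - l) := div_lt_pow (by omega) (hc u).1
      have hu2 : (clv l (c u)).2 < 2 ^ (N - l) := div_lt_pow (by omega) (hc u).2
      have hv1 : (clv l (c v)).1 < 2 ^ (N - l) := div_lt_pow (by omega) (hc v).1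
      have hv2 : (clv l (c v)).2 < 2 ^ (N - l) := div_lt_pow (by omega) (hc v).2
      obtain ⟨e1, f1, H1⟩ := mid1 _ _ h3.1 h3.2.1
      obtain ⟨e2, f2, H2⟩ := mid1 _ _ h3.2.2.1 h3.2.2.2
      obtain ⟨w, hw⟩ := hall (e1, e2) (by simp only; omega) (by simp only; omega)
        (by unfold nearC; simp only; omega) (by unfold nearC; simp only; omega)
      obtain ⟨w', hw'⟩ := hall (f1, f2) (by simp only; omega) (by simp only; omega)
        (by unfold nearC; simp only; omega) (by unfold nearC; simp only; omega)
      refine ((ih u w ?_).trans (ih w w' ?_)).trans (ih w' v ?_)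
      · rw [hw]; unfold nearC; simp only; omega
      · rw [hw, hw']; unfold nearC; simp only; omega
      · rw [hw']; unfold nearC; simp only; omega
    · push Not at hall
      obtain ⟨e, he1, he2, heu, hev, hemp⟩ := hall
      obtain ⟨p, hp, hpu⟩ := exists_rep c l u
      obtain ⟨q, hq, hqv⟩ := exists_rep c l v
      have hup : Relation.ReflTransGen E u p := by
        apply ih; rw [hpu]; unfold nearC; omega
      have hqv' : Relation.ReflTransGen E q v := by
        apply ih; rw [hqv]; unfold nearC; omega
      refine hup.trans (Relation.ReflTransGen.trans ?_ hqv')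
      by_cases hpq : p = q
      · rw [hpq]
      · apply Relation.ReflTransGen.single
        apply hE p q l hpq
        · apply le_lam _ _ _ _ (by omega)
          right
          exact ⟨hp, e, he1, he2, by rw [hpu]; exact heu, hemp⟩
        · rw [hpu, hqv]; exact h3

lemma conn_all {n : ℕ} (N : ℕ) (c : Fin n → ℕ × ℕ)
    (hc : ∀ i, (c i).1 < 2 ^ N ∧ (c i).2 < 2 ^ N)
    (E : Fin n → Fin n → Prop)
    (hE : ∀ i j l, i ≠ j → l ≤ lam N c i → nearC 3 (clv l (c i)) (clv l (c j)) → E i j)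
    (u v : Fin n) (huv : u ≠ v) : Relation.TransGen E u v := by
  have h := conn_aux N c hc E hE N le_rfl u v (by
    have := hc u; have := hc v
    unfold nearC clv
    simp only [Nat.div_eq_of_lt (hc u).1, Nat.div_eq_of_lt (hc u).2,
      Nat.div_eq_of_lt (hc v).1, Nat.div_eq_of_lt (hc v).2]
    omega)
  rcases Relation.reflTransGen_iff_eq_or_transGen.1 h with h | h
  · exact absurd h.symm huv
  · exact h

def FF (N l d : ℕ) (Q : ℕ × ℕ) : Finset (ℕ × ℕ) :=
  (Finset.range (2 ^ (N - l)) ×ˢ Finset.range (2 ^ (N - l))).filter fun e =>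
    (Q.1 * 2 ^ d ≤ e.1 + 3 ∧ e.1 < (Q.1 + 1) * 2 ^ d + 3) ∧
    (Q.2 * 2 ^ d ≤ e.2 + 3 ∧ e.2 < (Q.2 + 1) * 2 ^ d + 3)

open Classical in
lemma group_card {n : ℕ} (N : ℕ) (c : Fin n → ℕ × ℕ) (l d m : ℕ) (hl : l ≠ 0) (Q : ℕ × ℕ)
    (hm : ((FF N l d Q).filter fun e => ∀ j, clv l (c j) ≠ e).card ≤ m) :
    (Finset.univ.filter fun i => lam N c i = l ∧ clv (l + d) (c i) = Q).card ≤ m * 49 := by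
  set G := (FF N l d Q).filter fun e => ∀ j, clv l (c j) ≠ e with hG
  have key : (Finset.univ.filter fun i => lam N c i = l ∧ clv (l + d) (c i) = Q).card ≤
      (G.biUnion fun e => Finset.Icc (e.1 - 3) (e.1 + 3) ×ˢ Finset.Icc (e.2 - 3) (e.2 + 3)).card := by
    apply Finset.card_le_card_of_injOn (fun i => clv l (c i))
    · intro i hi
      simp only [Finset.coe_filter, Finset.mem_univ, true_and, Set.mem_ofPred_eq] at hi
      have hn := need_lam N c i
      rw [hi.1] at hn
      rcases hn with hn | ⟨hr, e, he1, he2, hne, hemp⟩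
      · exact absurd hn hl
      · have hQ := hi.2
        simp only [Finset.coe_biUnion, Set.mem_iUnion, Finset.mem_coe, Finset.mem_product,
          Finset.mem_Icc, exists_prop]
        refine ⟨e, ?_, ?_⟩
        · rw [hG, Finset.mem_filter]
          refine ⟨?_, hemp⟩
          unfold FF
          rw [Finset.mem_filter]
          refine ⟨by simp [he1, he2], ?_⟩
          rw [← hQ]
          unfold nearC clv at hne
          unfold clv
          simp only [pow_add, ← Nat.div_div_eq_div_mul] at hne ⊢
          have p : 0 < 2 ^ d := by positivity
          have a1 := Nat.div_mul_le_self ((c i).1 / 2 ^ l) (2 ^ d)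
          have a2 := Nat.div_mul_le_self ((c i).2 / 2 ^ l) (2 ^ d)
          have b1 := Nat.lt_mul_of_div_lt (Nat.lt_add_one ((c i).1 / 2 ^ l / 2 ^ d)) p
          have b2 := Nat.lt_mul_of_div_lt (Nat.lt_add_one ((c i).2 / 2 ^ l / 2 ^ d)) p
          omega
        · unfold nearC at hne
          omega
    · intro i hi j hj hij
      simp only [Finset.coe_filter, Finset.mem_univ, true_and, Set.mem_ofPred_eq] at hi hj
      have hni := need_lam N c i
      rw [hi.1] at hni
      have hnj := need_lam N c j
      rw [hj.1] at hnj
      rcases hni with hn | ⟨hri, -⟩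
      · exact absurd hn hl
      rcases hnj with hn | ⟨hrj, -⟩
      · exact absurd hn hl
      exact le_antisymm (hri j hij.symm) (hrj i hij)
  refine key.trans ((Finset.card_biUnion_le_card_mul _ _ 49 ?_).trans
    (Nat.mul_le_mul_right _ hm))
  intro e _
  rw [Finset.card_product, Nat.card_Icc, Nat.card_Icc]
  calc _ ≤ 7 * 7 := Nat.mul_le_mul (by omega) (by omega)
    _ = 49 := rfl

open Classical in
lemma exists_coloring {n N : ℕ} (s : Fin n → ℕ × ℕ) (la : Fin n → ℕ) (hla : ∀ i, la i ≤ N)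
    (g : ℕ → ℕ)
    (hg : ∀ i, (Finset.univ.filter fun k => la k = la i ∧ s k = s i).card ≤ g (la i)) :
    ∃ χ : Fin n → ℕ, (∀ i, χ i ∈ Finset.Icc 1 (∑ l ∈ Finset.range (N + 1), g l * 4)) ∧
      ∀ i j, χ i = χ j → la i = la j ∧ (s i).1 % 2 = (s j).1 % 2 ∧ (s i).2 % 2 = (s j).2 % 2 ∧
        (s i = s j → i = j) := by
  let rk : Fin n → ℕ := fun i =>
    (Finset.univ.filter fun k => (la k = la i ∧ s k = s i) ∧ k < i).card
  have hrk : ∀ i, rk i < g (la i) := by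
    intro i
    refine lt_of_lt_of_le ?_ (hg i)
    apply Finset.card_lt_card
    rw [Finset.ssubset_iff_of_subset]
    · exact ⟨i, by simp, by simp⟩
    · intro k hk
      simp only [Finset.mem_filter, Finset.mem_univ, true_and] at hk ⊢
      exact hk.1
  have hmono : ∀ i j, la i = la j → s i = s j → i < j → rk i < rk j := by
    intro i j h1 h2 hij
    apply Finset.card_lt_card
    rw [Finset.ssubset_iff_of_subset]
    · exact ⟨i, by simp [h1, h2, hij], by simp⟩
    · intro k hk
      simp only [Finset.mem_filter, Finset.mem_univ, true_and] at hk ⊢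
      exact ⟨⟨hk.1.1.trans h1, hk.1.2.trans h2⟩, hk.2.trans hij⟩
  let β := Σ l : Fin (N + 1), Fin (g l) × Fin 2 × Fin 2
  have hcard : Fintype.card β = ∑ l ∈ Finset.range (N + 1), g l * 4 := by
    simp [β, Fintype.card_sigma, Finset.sum_range]
  let e := Fintype.equivFin β
  let f : Fin n → β := fun i => ⟨⟨la i, Nat.lt_succ_of_le (hla i)⟩, ⟨rk i, hrk i⟩,
    ⟨(s i).1 % 2, Nat.mod_lt _ (by norm_num)⟩, ⟨(s i).2 % 2, Nat.mod_lt _ (by norm_num)⟩⟩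
  have hf : ∀ i j, f i = f j → la i = la j ∧ rk i = rk j ∧ (s i).1 % 2 = (s j).1 % 2 ∧
      (s i).2 % 2 = (s j).2 % 2 := by
    intro i j hij
    have q1 := congrArg (fun b : β => (b.1 : ℕ)) hij
    have q2 := congrArg (fun b : β => (b.2.1 : ℕ)) hij
    have q3 := congrArg (fun b : β => (b.2.2.1 : ℕ)) hij
    have q4 := congrArg (fun b : β => (b.2.2.2 : ℕ)) hij
    exact ⟨q1, q2, q3, q4⟩
  refine ⟨fun i => (e (f i) : ℕ) + 1, ?_, ?_⟩
  · intro i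
    have := (e (f i)).2.trans_eq hcard
    exact Finset.mem_Icc.2 ⟨Nat.le_add_left 1 _, this⟩
  · intro i j hij
    have h1 : f i = f j := e.injective (Fin.ext (by simpa using hij))
    obtain ⟨q1, q2, q3, q4⟩ := hf i j h1
    refine ⟨q1, q3, q4, fun hs => ?_⟩
    rcases lt_trichotomy i j with h | h | h
    · exact absurd q2 (hmono i j q1 hs h).ne
    · exact h
    · exact absurd q2 (hmono j i q1.symm hs.symm h).ne'

lemma sum_box_le (N M : ℕ) (hM : M ≤ 2 ^ N) (D : ℝ) (hD : 0 < D) {ι : Type*} (S : Finset ι)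
    (v : ι → ℤ × ℤ) (y : ι → ℝ) (hinj : Set.InjOn v S)
    (hv : ∀ k ∈ S, ∃ r : ℕ, 1 ≤ r ∧ r ≤ M ∧ v k ∈ Finset.box r ∧ (r : ℝ) * D / 2 ≤ y k) :
    ∑ k ∈ S, (y k ^ 2)⁻¹ ≤ 32 * (N + 1) / D ^ 2 := by
  classical
  let w : ℤ × ℤ → ℝ := fun m => 4 / ((max m.1.natAbs m.2.natAbs : ℕ) * D) ^ 2
  have hbox : ∀ r : ℕ, ∀ m ∈ (Finset.box r : Finset (ℤ × ℤ)), w m = 4 / (r * D) ^ 2 := by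
    intro r m hm
    rw [Int.mem_box] at hm
    simp only [w, hm]
  calc ∑ k ∈ S, (y k ^ 2)⁻¹ ≤ ∑ k ∈ S, w (v k) := by
        apply Finset.sum_le_sum
        intro k hk
        obtain ⟨r, h1, h2, h3, h4⟩ := hv k hk
        rw [hbox r _ h3]
        have hr : (0 : ℝ) < r := by exact_mod_cast h1
        have h5 : (0 : ℝ) < r * D := by positivity
        rw [show (4 : ℝ) / (r * D) ^ 2 = ((r * D / 2) ^ 2)⁻¹ by field_simp; norm_num]
        gcongr
    _ = ∑ m ∈ S.image v, w m := (Finset.sum_image (fun a ha b hb h => hinj ha hb h)).symm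
    _ ≤ ∑ m ∈ (Finset.Icc 1 M).biUnion (fun r => (Finset.box r : Finset (ℤ × ℤ))), w m := by
        apply Finset.sum_le_sum_of_subset_of_nonneg
        · intro m hm
          obtain ⟨k, hk, rfl⟩ := Finset.mem_image.1 hm
          obtain ⟨r, h1, h2, h3, h4⟩ := hv k hk
          exact Finset.mem_biUnion.2 ⟨r, Finset.mem_Icc.2 ⟨h1, h2⟩, h3⟩
        · intro m _ _
          positivity
    _ ≤ ∑ r ∈ Finset.Icc 1 M, ∑ m ∈ (Finset.box r : Finset (ℤ × ℤ)), w m := by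
        rw [Finset.sum_biUnion]
        intro a _ b _ hab
        rw [Function.onFun, Finset.disjoint_left]
        intro m h1 h2
        rw [Int.mem_box] at h1 h2
        exact hab (h1.symm.trans h2)
    _ = ∑ r ∈ Finset.Icc 1 M, 32 / D ^ 2 * (r : ℝ)⁻¹ := by
        apply Finset.sum_congr rfl
        intro r hr
        have hr1 : r ≠ 0 := by have := (Finset.mem_Icc.1 hr).1; omega
        have hr2 : (r : ℝ) ≠ 0 := by exact_mod_cast hr1
        rw [Finset.sum_congr rfl (hbox r), Finset.sum_const, Int.card_box hr1, nsmul_eq_mul]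
        push_cast
        field_simp
        norm_num
    _ = 32 / D ^ 2 * (harmonic M : ℚ) := by
        rw [← Finset.mul_sum, harmonic_eq_sum_Icc]
        push_cast
        rfl
    _ ≤ 32 / D ^ 2 * (N + 1) := by
        have hh : ((harmonic M : ℚ) : ℝ) ≤ N + 1 := by
          have h1 := harmonic_le_one_add_log M
          have h2 : Real.log M ≤ N := by
            rcases Nat.eq_zero_or_pos M with h0 | h0
            · simp [h0]
            calc Real.log M ≤ Real.log (2 ^ N) := by
                  apply Real.log_le_log
                  · exact_mod_cast h0
                  · exact_mod_cast hM
              _ = N * Real.log 2 := by rw [Real.log_pow]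
              _ ≤ N * 1 := by
                  gcongr
                  have := Real.log_two_lt_d9
                  linarith
              _ = N := mul_one _
          linarith
        gcongr
    _ = _ := by ring

/-- passing from exponent `2` to exponent `α`. -/
lemma pow_transfer (α T : ℝ) (hα : 2 ≤ α) (hT : 0 < T) {ι : Type*} (S : Finset ι)
    (y : ι → ℝ) (r : ℝ) (hr : 0 < r) (hy : ∀ k ∈ S, 0 < y k)
    (h : T ^ (2 / α) * ∑ k ∈ S, (y k ^ 2)⁻¹ ≤ (r ^ 2)⁻¹) :
    T * ∑ k ∈ S, y k ^ (-α) ≤ r ^ (-α) := by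
  have hα0 : 0 < α := by linarith
  have conv : ∀ z : ℝ, 0 < z → z ^ (-α) = ((z ^ 2)⁻¹) ^ (α / 2) := by
    intro z hz
    rw [← Real.rpow_natCast, ← Real.rpow_neg hz.le, ← Real.rpow_mul hz.le]
    congr 1
    push_cast
    ring
  set Y := ∑ k ∈ S, (y k ^ 2)⁻¹ with hY
  have hY0 : 0 ≤ Y := Finset.sum_nonneg fun k _ => by positivity
  have h1 : ∑ k ∈ S, y k ^ (-α) ≤ Y ^ (α / 2) := by
    rcases S.eq_empty_or_nonempty with he | hne
    · subst he
      simp only [Finset.sum_empty]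
      positivity
    have hYp : 0 < Y := Finset.sum_pos (fun k hk => by have := hy k hk; positivity) hne
    calc ∑ k ∈ S, y k ^ (-α) ≤ ∑ k ∈ S, (y k ^ 2)⁻¹ * Y ^ (α / 2 - 1) := by
          apply Finset.sum_le_sum
          intro k hk
          have hk0 : 0 < (y k ^ 2)⁻¹ := by have := hy k hk; positivity
          rw [conv _ (hy k hk)]
          rw [show α / 2 = 1 + (α / 2 - 1) by ring, Real.rpow_add hk0, Real.rpow_one]
          rw [show 1 + (α / 2 - 1) - 1 = α / 2 - 1 by ring]
          apply mul_le_mul_of_nonneg_left _ hk0.le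
          apply Real.rpow_le_rpow hk0.le _ (by linarith)
          exact Finset.single_le_sum (f := fun k => (y k ^ 2)⁻¹)
            (fun k _ => by positivity) hk
      _ = Y * Y ^ (α / 2 - 1) := by rw [← Finset.sum_mul]
      _ = Y ^ (α / 2) := by
          rw [← Real.rpow_one_add' hY0 (by linarith)]
          congr 1
          ring
  calc T * ∑ k ∈ S, y k ^ (-α) ≤ T * Y ^ (α / 2) := by gcongr
    _ = (T ^ (2 / α) * Y) ^ (α / 2) := by
        rw [Real.mul_rpow (by positivity) hY0, ← Real.rpow_mul hT.le]
        rw [show 2 / α * (α / 2) = 1 by field_simp, Real.rpow_one]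
    _ ≤ ((r ^ 2)⁻¹) ^ (α / 2) := by
        apply Real.rpow_le_rpow (by positivity) h (by linarith)
    _ = r ^ (-α) := (conv r hr).symm

def cellB (N : ℕ) (p : EE) : ℕ × ℕ := (⌊2 ^ N * p 0⌋₊, ⌊2 ^ N * p 1⌋₊)

lemma floor_bds (l : ℕ) (y : ℝ) (hy : 0 ≤ y) :
    ((⌊y⌋₊ / 2 ^ l : ℕ) : ℝ) * 2 ^ l ≤ y ∧ y < (((⌊y⌋₊ / 2 ^ l : ℕ) : ℝ) + 1) * 2 ^ l := by
  have h : (⌊y⌋₊ / 2 ^ l : ℕ) = ⌊y / ((2 ^ l : ℕ) : ℝ)⌋₊ := (Nat.floor_div_natCast _ _).symm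
  rw [h]
  push_cast
  have h2 : (0 : ℝ) < 2 ^ l := by positivity
  constructor
  · have := Nat.floor_le (show 0 ≤ y / 2 ^ l by positivity)
    rwa [le_div_iff₀ h2] at this
  · have := Nat.lt_floor_add_one (y / 2 ^ l)
    rwa [div_lt_iff₀ h2] at this

lemma abs_coord_le_dist (p q : EE) (a : Fin 2) : |p a - q a| ≤ dist p q := by
  have := PiLp.norm_apply_le (p - q) a
  rw [dist_eq_norm]
  simpa using this

lemma dist_le_coord (p q : EE) : dist p q ≤ |p 0 - q 0| + |p 1 - q 1| := by
  rw [EuclideanSpace.dist_eq]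
  apply Real.sqrt_le_iff.2
  refine ⟨by positivity, ?_⟩
  simp only [Fin.sum_univ_two, Real.dist_eq]
  nlinarith [abs_nonneg (p 0 - q 0), abs_nonneg (p 1 - q 1)]

lemma coord_up (l : ℕ) (y z : ℝ) (hy : 0 ≤ y) (hz : 0 ≤ z)
    (h1 : ⌊y⌋₊ / 2 ^ l ≤ ⌊z⌋₊ / 2 ^ l + 3) (h2 : ⌊z⌋₊ / 2 ^ l ≤ ⌊y⌋₊ / 2 ^ l + 3) :
    |y - z| ≤ 4 * 2 ^ l := by
  obtain ⟨a1, a2⟩ := floor_bds l y hy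
  obtain ⟨b1, b2⟩ := floor_bds l z hz
  have h1' : ((⌊y⌋₊ / 2 ^ l : ℕ) : ℝ) ≤ ((⌊z⌋₊ / 2 ^ l : ℕ) : ℝ) + 3 := by exact_mod_cast h1
  have h2' : ((⌊z⌋₊ / 2 ^ l : ℕ) : ℝ) ≤ ((⌊y⌋₊ / 2 ^ l : ℕ) : ℝ) + 3 := by exact_mod_cast h2
  have hp : (0 : ℝ) < 2 ^ l := by positivity
  rw [abs_le]
  constructor <;> nlinarith

lemma coord_low (L d : ℕ) (hd : 16 ≤ 2 ^ d) (yk yi yj : ℝ) (hk : 0 ≤ yk) (hi : 0 ≤ yi)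
    (z : ℤ) (hz : ((⌊yk⌋₊ / 2 ^ (L + d) : ℕ) : ℤ) - ((⌊yi⌋₊ / 2 ^ (L + d) : ℕ) : ℤ) = 2 * z)
    (r : ℕ) (hr : 1 ≤ r) (hzr : z.natAbs = r) (hij : |yi - yj| ≤ 4 * 2 ^ L) :
    (r : ℝ) * 2 ^ (L + d) / 2 ≤ |yk - yj| := by
  obtain ⟨a1, a2⟩ := floor_bds (L + d) yk hk
  obtain ⟨b1, b2⟩ := floor_bds (L + d) yi hi
  set K := ((⌊yk⌋₊ / 2 ^ (L + d) : ℕ) : ℝ) with hK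
  set I := ((⌊yi⌋₊ / 2 ^ (L + d) : ℕ) : ℝ) with hI
  have hz' : K - I = 2 * (z : ℝ) := by rw [hK, hI]; exact_mod_cast hz
  have hW : (4 : ℝ) * 2 ^ L ≤ 2 ^ (L + d) / 4 := by
    have : (16 : ℝ) ≤ 2 ^ d := by exact_mod_cast hd
    rw [pow_add]
    have hp : (0 : ℝ) < 2 ^ L := by positivity
    nlinarith
  have hp : (0 : ℝ) < 2 ^ (L + d) := by positivity
  set W : ℝ := 2 ^ (L + d) with hWdef
  have hr' : (1 : ℝ) ≤ r := by exact_mod_cast hr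
  rw [abs_le] at hij
  rcases Int.natAbs_eq z with h | h
  · have hzz : (z : ℝ) = r := by rw [h, hzr]; simp
    refine le_trans ?_ (le_abs_self _)
    have e : K = I + 2 * r := by linarith
    rw [e] at a1
    nlinarith [mul_le_mul_of_nonneg_right hr' hp.le]
  · have hzz : (z : ℝ) = -r := by rw [h, hzr]; simp
    refine le_trans ?_ (neg_le_abs _)
    have e : I = K + 2 * r := by linarith
    rw [e] at b1
    nlinarith [mul_le_mul_of_nonneg_right hr' hp.le]

lemma cell_lt {N : ℕ} {y : ℝ} (h : y ∈ Set.Ico (0 : ℝ) 1) : ⌊2 ^ N * y⌋₊ < 2 ^ N := by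
  rw [Nat.floor_lt (mul_nonneg (by positivity) h.1)]
  push_cast
  have hp : (0 : ℝ) < 2 ^ N := by positivity
  nlinarith [h.2]

lemma div_lt' {a l M : ℕ} (h : a < M) : a / 2 ^ l < M := lt_of_le_of_lt (Nat.div_le_self _ _) h

lemma scale_abs (N : ℕ) (a b : ℝ) : |2 ^ N * a - 2 ^ N * b| = 2 ^ N * |a - b| := by
  rw [← mul_sub, abs_mul, abs_of_pos (by positivity : (0 : ℝ) < 2 ^ N)]

open Classical in
theorem det_main (α T : ℝ) (hα : 2 ≤ α) (hT : 0 < T) (n N d : ℕ) (x : Fin n → EE)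
    (hx : ∀ i a, x i a ∈ Set.Ico (0 : ℝ) 1) (hinj : Function.Injective x)
    (hd : 16 ≤ 2 ^ d) (hd2 : 2048 * T ^ (2 / α) * (N + 1) ≤ 4 ^ d) (m0 : ℕ) (m : ℕ → ℕ)
    (h0 : ∀ Q ∈ Finset.range (2 ^ N) ×ˢ Finset.range (2 ^ N),
      (Finset.univ.filter fun i => clv d (cellB N (x i)) = Q).card ≤ m0)
    (hm : ∀ l ∈ Finset.Ico 1 (N + 1), ∀ Q ∈ Finset.range (2 ^ N) ×ˢ Finset.range (2 ^ N),
      ((FF N l d Q).filter fun e => ∀ j, clv l (cellB N (x j)) ≠ e).card ≤ m l) :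
    ∃ χ : Fin n → ℕ, (∀ i, χ i ∈ Finset.Icc 1
      (∑ l ∈ Finset.range (N + 1), (if l = 0 then m0 else m l * 49) * 4)) ∧
      sirConnected α T x χ := by
  set c : Fin n → ℕ × ℕ := fun i => cellB N (x i) with hc
  have hcl : ∀ i, (c i).1 < 2 ^ N ∧ (c i).2 < 2 ^ N := fun i =>
    ⟨cell_lt (hx i 0), cell_lt (hx i 1)⟩
  set s : Fin n → ℕ × ℕ := fun i => clv (lam N c i + d) (c i) with hs
  have hsl : ∀ i, (s i).1 < 2 ^ N ∧ (s i).2 < 2 ^ N := fun i =>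
    ⟨div_lt' (hcl i).1, div_lt' (hcl i).2⟩
  obtain ⟨χ, hχ1, hχ2⟩ := exists_coloring s (lam N c) (lam_le N c)
    (fun l => if l = 0 then m0 else m l * 49) (by
      intro i
      have hQ : s i ∈ Finset.range (2 ^ N) ×ˢ Finset.range (2 ^ N) := by
        simp [hsl i]
      by_cases hl : lam N c i = 0
      · rw [if_pos hl]
        refine le_trans (Finset.card_le_card ?_) (h0 (s i) hQ)
        intro k hk
        simp only [Finset.mem_filter, Finset.mem_univ, true_and] at hk ⊢
        rw [← hk.2]
        change clv d (c k) = clv (lam N c k + d) (c k)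
        rw [hk.1, hl, Nat.zero_add]
      · rw [if_neg hl]
        have hmem : lam N c i ∈ Finset.Ico 1 (N + 1) :=
          Finset.mem_Ico.2 ⟨Nat.pos_of_ne_zero hl, Nat.lt_succ_of_le (lam_le N c i)⟩
        refine le_trans (Finset.card_le_card ?_)
          (group_card N c (lam N c i) d _ hl (s i) (hm _ hmem _ hQ))
        intro k hk
        simp only [Finset.mem_filter, Finset.mem_univ, true_and] at hk ⊢
        refine ⟨hk.1, ?_⟩
        rw [← hk.2]
        simp only [hs, hk.1])
  refine ⟨χ, hχ1, ?_⟩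
  intro u v huv
  apply conn_all N c hcl _ _ u v huv
  intro i j l hij hl hnear
  refine ⟨hij, ?_⟩
  set L := lam N c i with hL
  have hp : (0 : ℝ) < 2 ^ N := by positivity
  have hnn : ∀ i a, 0 ≤ 2 ^ N * x i a := fun i a => mul_nonneg hp.le (hx i a).1
  have hlL : (2 : ℝ) ^ l ≤ 2 ^ L := pow_le_pow_right₀ (by norm_num) hl
  have hc0 : |2 ^ N * x i 0 - 2 ^ N * x j 0| ≤ 4 * 2 ^ L :=
    (coord_up l _ _ (hnn i 0) (hnn j 0) hnear.1 hnear.2.1).trans (by linarith)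
  have hc1 : |2 ^ N * x i 1 - 2 ^ N * x j 1| ≤ 4 * 2 ^ L :=
    (coord_up l _ _ (hnn i 1) (hnn j 1) hnear.2.2.1 hnear.2.2.2).trans (by linarith)
  have hdist : 2 ^ N * dist (x i) (x j) ≤ 8 * 2 ^ L := by
    have := dist_le_coord (x i) (x j)
    rw [scale_abs] at hc0 hc1
    nlinarith
  have hr : 0 < dist (x i) (x j) := dist_pos.2 fun h => hij (hinj h)
  set D : ℝ := 2 ^ (L + d) / 2 ^ N with hD
  have hDpos : 0 < D := by positivity
  set S := Finset.univ.filter fun k => k ≠ i ∧ χ k = χ i with hS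
  let v : Fin n → ℤ × ℤ := fun k =>
    ((((s k).1 : ℤ) - (s i).1) / 2, (((s k).2 : ℤ) - (s i).2) / 2)
  have hcol : ∀ k ∈ S, lam N c k = L ∧ ((s k).1 : ℤ) - (s i).1 = 2 * (v k).1 ∧
      ((s k).2 : ℤ) - (s i).2 = 2 * (v k).2 ∧ s k ≠ s i := by
    intro k hk
    rw [hS, Finset.mem_filter] at hk
    obtain ⟨q1, q2, q3, q4⟩ := hχ2 k i hk.2.2
    refine ⟨q1, ?_, ?_, fun h => hk.2.1 (q4 h)⟩
    · simp only [v]; omega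
    · simp only [v]; omega
  have hv : ∀ k ∈ S, ∃ r : ℕ, 1 ≤ r ∧ r ≤ 2 ^ N ∧ v k ∈ Finset.box r ∧
      (r : ℝ) * D / 2 ≤ dist (x k) (x j) := by
    intro k hk
    obtain ⟨q1, q2, q3, q4⟩ := hcol k hk
    have hki := hsl k
    have hii := hsl i
    refine ⟨max (v k).1.natAbs (v k).2.natAbs, ?_, ?_, Int.mem_box.2 rfl, ?_⟩
    · by_contra hcon
      apply q4
      ext <;> omega
    · omega
    · set r := max (v k).1.natAbs (v k).2.natAbs with hrdef
      have hr1 : 1 ≤ r := by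
        by_contra hcon
        apply q4
        ext <;> omega
      have main : ∀ a : Fin 2, (r : ℝ) * 2 ^ (L + d) / 2 ≤ |2 ^ N * x k a - 2 ^ N * x j a| →
          (r : ℝ) * D / 2 ≤ dist (x k) (x j) := by
        intro a ha
        rw [scale_abs] at ha
        have hb := abs_coord_le_dist (x k) (x j) a
        have : (r : ℝ) * D / 2 = ((r : ℝ) * 2 ^ (L + d) / 2) / 2 ^ N := by rw [hD]; ring
        rw [this, div_le_iff₀ hp]
        nlinarith
      simp only [hs, q1, ← hL, clv] at q2 q3
      rcases max_choice (v k).1.natAbs (v k).2.natAbs with hh | hh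
      · apply main 0
        exact coord_low L d hd _ (2 ^ N * x i 0) _ (hnn k 0) (hnn i 0) _ q2 r hr1
          (by rw [hrdef, hh]) hc0
      · apply main 1
        exact coord_low L d hd _ (2 ^ N * x i 1) _ (hnn k 1) (hnn i 1) _ q3 r hr1
          (by rw [hrdef, hh]) hc1
  apply pow_transfer α T hα hT S _ _ hr
  · intro k hk
    obtain ⟨r, h1, -, -, h4⟩ := hv k hk
    have : (0 : ℝ) < r := by exact_mod_cast h1
    exact lt_of_lt_of_le (by positivity) h4
  · have hsum := sum_box_le N (2 ^ N) le_rfl D hDpos S v (fun k => dist (x k) (x j)) (by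
      intro k hk k' hk' hkk
      obtain ⟨q1, q2, q3, q4⟩ := hcol k hk
      obtain ⟨q1', q2', q3', q4'⟩ := hcol k' hk'
      have hk1 := (Finset.mem_filter.1 hk).2.2
      have hk2 := (Finset.mem_filter.1 hk').2.2
      apply (hχ2 k k' (hk1.trans hk2.symm)).2.2.2
      rw [hkk] at q2 q3
      ext <;> omega) hv
    have hT' : 0 < T ^ (2 / α) := by positivity
    calc T ^ (2 / α) * ∑ k ∈ S, (dist (x k) (x j) ^ 2)⁻¹
        ≤ T ^ (2 / α) * (32 * (N + 1) / D ^ 2) := by gcongr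
      _ = (2048 * T ^ (2 / α) * (N + 1)) / (64 * D ^ 2) := by
          field_simp; norm_num
      _ ≤ 4 ^ d / (64 * D ^ 2) := by gcongr
      _ = ((8 * 2 ^ L / 2 ^ N) ^ 2)⁻¹ := by
          rw [hD, show (4 : ℝ) = 2 ^ 2 by norm_num, ← pow_mul, pow_add]
          field_simp
          ring
      _ ≤ (dist (x i) (x j) ^ 2)⁻¹ := by
          have : dist (x i) (x j) ≤ 8 * 2 ^ L / 2 ^ N := by
            rw [le_div_iff₀ hp]; linarith
          gcongr

lemma vol_box (f g : Fin 2 → ℝ) :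
    volume {p : EE | ∀ a, p a ∈ Set.Ico (f a) (g a)} = ∏ a, ENNReal.ofReal (g a - f a) := by
  have h := (PiLp.volume_preserving_ofLp (Fin 2)).measure_preimage
    (s := Set.univ.pi fun a => Set.Ico (f a) (g a))
    (MeasurableSet.univ_pi fun a => measurableSet_Ico).nullMeasurableSet
  rw [Real.volume_pi_Ico] at h
  rw [← h]
  congr 1
  ext p
  simp

lemma vol_unit : volume unitSquare = 1 := by
  have h := (PiLp.volume_preserving_ofLp (Fin 2)).measure_preimage
    (s := Set.Icc (fun _ => (0 : ℝ)) (fun _ => 1)) measurableSet_Icc.nullMeasurableSet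
  rw [Real.volume_Icc_pi] at h
  simp only [sub_zero, ENNReal.ofReal_one, Finset.prod_const_one] at h
  rw [← h]
  congr 1
  ext p
  simp only [unitSquare, Set.mem_Icc, Set.mem_preimage, Pi.le_def]
  exact ⟨fun h => ⟨fun i => (h i).1, fun i => (h i).2⟩, fun h i => ⟨h.1 i, h.2 i⟩⟩

instance prob_mu : IsProbabilityMeasure (volume.restrict unitSquare) :=
  ⟨by rw [Measure.restrict_apply_univ, vol_unit]⟩

lemma meas_coord (a : Fin 2) : Measurable fun p : EE => p a := by fun_prop

lemma meas_box (f g : Fin 2 → ℝ) : MeasurableSet {p : EE | ∀ a, p a ∈ Set.Ico (f a) (g a)} := by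
  rw [show {p : EE | ∀ a, p a ∈ Set.Ico (f a) (g a)} =
    ⋂ a, (fun p : EE => p a) ⁻¹' Set.Ico (f a) (g a) by ext; simp]
  exact MeasurableSet.iInter fun a => meas_coord a measurableSet_Ico

lemma half_null : (volume.restrict unitSquare) {p : EE | ¬ ∀ a, p a ∈ Set.Ico (0 : ℝ) 1} = 0 := by
  have hm := meas_box (fun _ => 0) (fun _ => 1)
  have hsub : {p : EE | ∀ a, p a ∈ Set.Ico (0 : ℝ) 1} ⊆ unitSquare :=
    fun p hp a => ⟨(hp a).1, (hp a).2.le⟩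
  have h1 : (volume.restrict unitSquare) {p : EE | ∀ a, p a ∈ Set.Ico (0 : ℝ) 1} = 1 := by
    rw [Measure.restrict_apply hm, Set.inter_eq_left.2 hsub, vol_box]
    simp
  have := prob_compl_eq_zero_iff (μ := volume.restrict unitSquare) hm
  exact this.2 h1

lemma meas_cell (N l : ℕ) : Measurable fun p : EE => clv l (cellB N p) := by
  have h1 : Measurable fun p : EE => cellB N p := by
    unfold cellB
    apply Measurable.prodMk
    · exact Nat.measurable_floor.comp ((meas_coord 0).const_mul _)
    · exact Nat.measurable_floor.comp ((meas_coord 1).const_mul _)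
  exact (measurable_of_countable (clv l)).comp h1

lemma meas_cell_set (N l : ℕ) (e : ℕ × ℕ) : MeasurableSet {p : EE | clv l (cellB N p) = e} :=
  meas_cell N l (measurableSet_singleton e)

lemma cell_iff (N l e : ℕ) (y : ℝ) (hy : 0 ≤ y) : ⌊2 ^ N * y⌋₊ / 2 ^ l = e ↔
    y ∈ Set.Ico (e * (2 ^ l / 2 ^ N) : ℝ) ((e + 1) * (2 ^ l / 2 ^ N)) := by
  have h : (⌊2 ^ N * y⌋₊ / 2 ^ l : ℕ) = ⌊2 ^ N * y / ((2 ^ l : ℕ) : ℝ)⌋₊ :=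
    (Nat.floor_div_natCast _ _).symm
  rw [h, Nat.floor_eq_iff (by positivity)]
  push_cast
  rw [Set.mem_Ico, le_div_iff₀ (by positivity), div_lt_iff₀ (by positivity),
    ← mul_div_assoc, ← mul_div_assoc, div_le_iff₀ (by positivity), lt_div_iff₀ (by positivity),
    mul_comm y]

lemma prod_side (N l : ℕ) (e : ℕ × ℕ) :
    volume {p : EE | ∀ a, p a ∈ Set.Ico ((![(e.1 : ℝ), e.2] a) * (2 ^ l / 2 ^ N))
      ((![(e.1 : ℝ), e.2] a + 1) * (2 ^ l / 2 ^ N))} = ENNReal.ofReal ((2 ^ l / 2 ^ N) ^ 2) := by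
  rw [vol_box, Fin.prod_univ_two, ← ENNReal.ofReal_mul]
  · congr 1
    ring
  · ring_nf
    positivity

lemma cell_upper (N l : ℕ) (e : ℕ × ℕ) :
    (volume.restrict unitSquare) {p : EE | clv l (cellB N p) = e} ≤
      ENNReal.ofReal ((2 ^ l / 2 ^ N) ^ 2) := by
  rw [Measure.restrict_apply (meas_cell_set N l e), ← prod_side N l e]
  apply measure_mono
  rintro p ⟨hp, hu⟩
  have hp1 : ⌊2 ^ N * p 0⌋₊ / 2 ^ l = e.1 := congrArg Prod.fst hp
  have hp2 : ⌊2 ^ N * p 1⌋₊ / 2 ^ l = e.2 := congrArg Prod.snd hp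
  rw [cell_iff _ _ _ _ (hu 0).1] at hp1
  rw [cell_iff _ _ _ _ (hu 1).1] at hp2
  intro a
  fin_cases a
  · exact hp1
  · exact hp2

lemma cell_lower (N l : ℕ) (hl : l ≤ N) (e : ℕ × ℕ) (h1 : e.1 < 2 ^ (N - l))
    (h2 : e.2 < 2 ^ (N - l)) : ENNReal.ofReal ((2 ^ l / 2 ^ N) ^ 2) ≤
    (volume.restrict unitSquare) {p : EE | clv l (cellB N p) = e} := by
  rw [Measure.restrict_apply (meas_cell_set N l e), ← prod_side N l e]
  apply measure_mono
  have aux : ∀ (y : ℝ) (e : ℕ), e < 2 ^ (N - l) →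
      y ∈ Set.Ico (e * (2 ^ l / 2 ^ N) : ℝ) ((e + 1) * (2 ^ l / 2 ^ N)) → y ∈ Set.Icc (0 : ℝ) 1 := by
    intro y e he hy
    refine ⟨le_trans (by positivity) hy.1, hy.2.le.trans ?_⟩
    have h3 : ((e : ℝ) + 1) ≤ 2 ^ (N - l) := by exact_mod_cast he
    calc ((e : ℝ) + 1) * (2 ^ l / 2 ^ N) ≤ 2 ^ (N - l) * (2 ^ l / 2 ^ N) := by gcongr
      _ = 1 := by
        rw [← mul_div_assoc, ← pow_add, Nat.sub_add_cancel hl, div_self (by positivity)]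
  intro p hp
  have hp0 := hp 0
  have hp1 := hp 1
  simp only [Matrix.cons_val_zero, Matrix.cons_val_one] at hp0 hp1
  have q0 := aux _ _ h1 hp0
  have q1 := aux _ _ h2 hp1
  refine ⟨?_, ?_⟩
  · exact Prod.ext ((cell_iff _ _ _ _ q0.1).2 hp0) ((cell_iff _ _ _ _ q1.1).2 hp1)
  · intro a
    fin_cases a
    · exact q0
    · exact q1

abbrev PP (n : ℕ) : Measure (Fin n → EE) :=
  Measure.pi (fun _ : Fin n => volume.restrict unitSquare)

lemma prob_empty (n N l : ℕ) (hl : l ≤ N) (F : Finset (ℕ × ℕ))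
    (hF : ∀ e ∈ F, e.1 < 2 ^ (N - l) ∧ e.2 < 2 ^ (N - l)) :
    PP n {x | ∀ i, clv l (cellB N (x i)) ∉ F} ≤
      ENNReal.ofReal (Real.exp (-(n * (F.card * (2 ^ l / 2 ^ N) ^ 2)))) := by
  set μ := volume.restrict unitSquare with hμ
  have hmeas : MeasurableSet {p : EE | clv l (cellB N p) ∈ F} :=
    meas_cell N l F.measurableSet
  have h1 : ENNReal.ofReal (F.card * (2 ^ l / 2 ^ N) ^ 2) ≤ μ {p : EE | clv l (cellB N p) ∈ F} := by
    have : μ {p : EE | clv l (cellB N p) ∈ F} = ∑ e ∈ F, μ {p : EE | clv l (cellB N p) = e} := by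
      have := sum_measure_preimage_singleton (μ := μ) F (f := fun p : EE => clv l (cellB N p))
        (fun e _ => meas_cell N l (measurableSet_singleton e))
      exact this.symm
    rw [this]
    calc ENNReal.ofReal (F.card * (2 ^ l / 2 ^ N) ^ 2)
        = ∑ e ∈ F, ENNReal.ofReal ((2 ^ l / 2 ^ N) ^ 2) := by
          rw [Finset.sum_const, nsmul_eq_mul, ENNReal.ofReal_mul (by positivity),
            ENNReal.ofReal_natCast]
      _ ≤ _ := Finset.sum_le_sum fun e he => cell_lower N l hl e (hF e he).1 (hF e he).2
  have h2 : μ {p : EE | clv l (cellB N p) ∉ F} ≤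
      ENNReal.ofReal (Real.exp (-(F.card * (2 ^ l / 2 ^ N) ^ 2))) := by
    have : μ {p : EE | clv l (cellB N p) ∉ F} = 1 - μ {p : EE | clv l (cellB N p) ∈ F} :=
      prob_compl_eq_one_sub hmeas
    rw [this]
    calc 1 - μ {p : EE | clv l (cellB N p) ∈ F}
        ≤ 1 - ENNReal.ofReal (F.card * (2 ^ l / 2 ^ N) ^ 2) := by gcongr
      _ = ENNReal.ofReal (1 - F.card * (2 ^ l / 2 ^ N) ^ 2) := by
          rw [ENNReal.ofReal_sub _ (by positivity), ENNReal.ofReal_one]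
      _ ≤ _ := by
          apply ENNReal.ofReal_le_ofReal
          have := Real.add_one_le_exp (-((F.card : ℝ) * (2 ^ l / 2 ^ N) ^ 2))
          linarith
  have h3 : {x : Fin n → EE | ∀ i, clv l (cellB N (x i)) ∉ F} =
      Set.univ.pi fun _ => {p : EE | clv l (cellB N p) ∉ F} := by
    ext x; simp
  rw [h3, PP, Measure.pi_pi, Finset.prod_const, Finset.card_univ, Fintype.card_fin]
  calc _ ≤ (ENNReal.ofReal (Real.exp (-(F.card * (2 ^ l / 2 ^ N) ^ 2)))) ^ n := by gcongr
    _ = _ := by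
      rw [← ENNReal.ofReal_pow (by positivity), ← Real.exp_nat_mul]
      congr 2
      ring

lemma prob_many (n N d : ℕ) (Q : ℕ × ℕ) (S : Finset (Fin n)) :
    PP n {x | ∀ i ∈ S, clv d (cellB N (x i)) = Q} ≤
      ENNReal.ofReal (((2 ^ d / 2 ^ N) ^ 2) ^ S.card) := by
  classical
  have h3 : {x : Fin n → EE | ∀ i ∈ S, clv d (cellB N (x i)) = Q} =
      Set.univ.pi fun i => if i ∈ S then {p : EE | clv d (cellB N p) = Q} else Set.univ := by
    ext x
    simp only [Set.mem_pi, Set.mem_univ, true_implies]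
    apply forall_congr'
    intro i
    by_cases h : i ∈ S <;> simp [h]
  rw [h3, PP, Measure.pi_pi]
  calc _ = ∏ i : Fin n, if i ∈ S then
        (volume.restrict unitSquare) {p : EE | clv d (cellB N p) = Q} else 1 := by
        apply Finset.prod_congr rfl
        intro i _
        by_cases h : i ∈ S
        · simp only [h, if_true]
        · simp only [h, if_false, measure_univ]
    _ = ((volume.restrict unitSquare) {p : EE | clv d (cellB N p) = Q}) ^ S.card := by
        rw [Finset.prod_ite_mem, Finset.univ_inter, Finset.prod_const]
    _ ≤ (ENNReal.ofReal ((2 ^ d / 2 ^ N) ^ 2)) ^ S.card := by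
        gcongr
        exact cell_upper N d Q
    _ = _ := (ENNReal.ofReal_pow (by positivity) _).symm

lemma prob_noninj (n : ℕ) : PP n {x | ¬ Function.Injective x} = 0 := by
  have hsub : {x : Fin n → EE | ¬ Function.Injective x} ⊆
      ⋃ i : Fin n, ⋃ j : Fin n, {x | i ≠ j ∧ x i = x j} := by
    intro x hx
    simp only [Function.Injective, Set.mem_ofPred_eq] at hx
    push Not at hx
    obtain ⟨i, j, h1, h2⟩ := hx
    simp only [Set.mem_iUnion]
    exact ⟨i, j, h2, h1⟩
  refine measure_mono_null hsub ?_
  rw [measure_iUnion_null_iff]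
  intro i
  rw [measure_iUnion_null_iff]
  intro j
  by_cases hij : i = j
  · simp [hij]
  rw [PP, ← Measure.restrict_pi_pi]
  refine le_antisymm ((Measure.restrict_apply_le _ _).trans ?_) zero_le
  rw [← volume_pi]
  let K : Submodule ℝ (Fin n → EE) :=
    LinearMap.ker (LinearMap.proj (R := ℝ) (φ := fun _ : Fin n => EE) i - LinearMap.proj j)
  have hK : volume (K : Set (Fin n → EE)) = 0 := by
    apply Measure.addHaar_submodule
    intro htop
    have : (Pi.single i (EuclideanSpace.single 0 1) : Fin n → EE) ∈ K := by rw [htop]; trivial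
    simp only [K, LinearMap.mem_ker, LinearMap.sub_apply, LinearMap.proj_apply,
      Pi.single_eq_same, Pi.single_eq_of_ne (Ne.symm hij), sub_zero] at this
    have := congrArg (fun p : EE => p 0) this
    simp at this
  refine le_trans (measure_mono ?_) hK.le
  intro x hx
  have := hx.2
  simp [K, this]

lemma prob_half (n : ℕ) : PP n {x | ¬ ∀ i a, x i a ∈ Set.Ico (0 : ℝ) 1} = 0 := by
  have hsub : {x : Fin n → EE | ¬ ∀ i a, x i a ∈ Set.Ico (0 : ℝ) 1} ⊆
      ⋃ i : Fin n, (fun x => x i) ⁻¹' {p : EE | ¬ ∀ a, p a ∈ Set.Ico (0 : ℝ) 1} := by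
    intro x hx
    simp only [Set.mem_ofPred_eq] at hx
    rw [not_forall] at hx
    obtain ⟨i, hi⟩ := hx
    exact Set.mem_iUnion.2 ⟨i, hi⟩
  refine measure_mono_null hsub ?_
  rw [measure_iUnion_null_iff]
  intro i
  have := (measurePreserving_eval (fun _ : Fin n => volume.restrict unitSquare) i).measure_preimage
    (s := {p : EE | ¬ ∀ a, p a ∈ Set.Ico (0 : ℝ) 1})
    (meas_box (fun _ => 0) (fun _ => 1)).compl.nullMeasurableSet
  rw [half_null] at this
  exact this

lemma FF_card (N l d : ℕ) (hd : 16 ≤ 2 ^ d) (Q : ℕ × ℕ) : (FF N l d Q).card ≤ 4 * 4 ^ d := by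
  have hsub : FF N l d Q ⊆ Finset.Ico (Q.1 * 2 ^ d - 3) ((Q.1 + 1) * 2 ^ d + 3) ×ˢ
      Finset.Ico (Q.2 * 2 ^ d - 3) ((Q.2 + 1) * 2 ^ d + 3) := by
    intro e he
    have := (Finset.mem_filter.1 he).2
    rw [Finset.mem_product, Finset.mem_Ico, Finset.mem_Ico]
    omega
  refine (Finset.card_le_card hsub).trans ?_
  rw [Finset.card_product, Nat.card_Ico, Nat.card_Ico]
  have e4 : (4 : ℕ) ^ d = 2 ^ d * 2 ^ d := by rw [← mul_pow]; norm_num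
  rw [e4]
  have h1 : (Q.1 + 1) * 2 ^ d + 3 - (Q.1 * 2 ^ d - 3) ≤ 2 * 2 ^ d := by
    rw [add_mul]; omega
  have h2 : (Q.2 + 1) * 2 ^ d + 3 - (Q.2 * 2 ^ d - 3) ≤ 2 * 2 ^ d := by
    rw [add_mul]; omega
  calc _ ≤ (2 * 2 ^ d) * (2 * 2 ^ d) := Nat.mul_le_mul h1 h2
    _ = _ := by ring

lemma side_sq (N l : ℕ) : ((2 : ℝ) ^ l / 2 ^ N) ^ 2 = 4 ^ l / 4 ^ N := by
  rw [div_pow, ← pow_mul, ← pow_mul, mul_comm l, mul_comm N, pow_mul, pow_mul]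
  norm_num

open Classical in
lemma emp_event (n N l d m : ℕ) (hl : l ≤ N) (Q : ℕ × ℕ) :
    PP n {x | ¬ ((FF N l d Q).filter fun e => ∀ j, clv l (cellB N (x j)) ≠ e).card ≤ m} ≤
      ENNReal.ofReal (2 ^ (FF N l d Q).card *
        Real.exp (-(n * ((m + 1) * (4 ^ l / 4 ^ N))))) := by
  have hsub : {x : Fin n → EE |
      ¬ ((FF N l d Q).filter fun e => ∀ j, clv l (cellB N (x j)) ≠ e).card ≤ m} ⊆
      ⋃ F ∈ (FF N l d Q).powersetCard (m + 1), {x | ∀ i, clv l (cellB N (x i)) ∉ F} := by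
    intro x hx
    have hx' : m + 1 ≤ ((FF N l d Q).filter fun e => ∀ j, clv l (cellB N (x j)) ≠ e).card :=
      Nat.lt_of_not_le hx
    obtain ⟨F, hF1, hF2⟩ := Finset.exists_subset_card_eq hx'
    simp only [Set.mem_iUnion]
    refine ⟨F, Finset.mem_powersetCard.2 ⟨fun e he => (Finset.mem_filter.1 (hF1 he)).1, hF2⟩, ?_⟩
    intro i hi
    exact (Finset.mem_filter.1 (hF1 hi)).2 i rfl
  refine (measure_mono hsub).trans ((measure_biUnion_finset_le _ _).trans ?_)
  calc _ ≤ ∑ F ∈ (FF N l d Q).powersetCard (m + 1),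
        ENNReal.ofReal (Real.exp (-(n * ((m + 1) * (4 ^ l / 4 ^ N))))) := by
        apply Finset.sum_le_sum
        intro F hF
        obtain ⟨hF1, hF2⟩ := Finset.mem_powersetCard.1 hF
        have := prob_empty n N l hl F (fun e he => by
          have := (Finset.mem_filter.1 (hF1 he)).1
          rw [Finset.mem_product, Finset.mem_range, Finset.mem_range] at this
          exact this)
        rw [hF2, side_sq] at this
        push_cast at this
        exact this
    _ = ENNReal.ofReal (((FF N l d Q).powersetCard (m + 1)).card *
          Real.exp (-(n * ((m + 1) * (4 ^ l / 4 ^ N))))) := by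
        rw [Finset.sum_const, nsmul_eq_mul, ENNReal.ofReal_mul (by positivity),
            ENNReal.ofReal_natCast]
    _ ≤ _ := by
        apply ENNReal.ofReal_le_ofReal
        gcongr
        have : ((FF N l d Q).powersetCard (m + 1)).card ≤ (FF N l d Q).powerset.card :=
          Finset.card_le_card fun F hF =>
            Finset.mem_powerset.2 (Finset.mem_powersetCard.1 hF).1
        rw [Finset.card_powerset] at this
        exact_mod_cast this

open Classical in
lemma many_event (n N d m : ℕ) (Q : ℕ × ℕ) :
    PP n {x | ¬ (Finset.univ.filter fun i => clv d (cellB N (x i)) = Q).card ≤ m} ≤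
      ENNReal.ofReal (Real.exp (3 * (n * (4 ^ d / 4 ^ N)) - (m + 1))) := by
  have hsub : {x : Fin n → EE |
      ¬ (Finset.univ.filter fun i => clv d (cellB N (x i)) = Q).card ≤ m} ⊆
      ⋃ S ∈ (Finset.univ : Finset (Fin n)).powersetCard (m + 1),
        {x | ∀ i ∈ S, clv d (cellB N (x i)) = Q} := by
    intro x hx
    have hx' : m + 1 ≤ (Finset.univ.filter fun i => clv d (cellB N (x i)) = Q).card :=
      Nat.lt_of_not_le hx
    obtain ⟨F, hF1, hF2⟩ := Finset.exists_subset_card_eq hx'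
    simp only [Set.mem_iUnion]
    refine ⟨F, Finset.mem_powersetCard.2 ⟨Finset.subset_univ _, hF2⟩, ?_⟩
    intro i hi
    exact (Finset.mem_filter.1 (hF1 hi)).2
  refine (measure_mono hsub).trans ((measure_biUnion_finset_le _ _).trans ?_)
  set σ : ℝ := 4 ^ d / 4 ^ N with hσ
  have hσ0 : 0 ≤ σ := by positivity
  calc _ ≤ ∑ S ∈ (Finset.univ : Finset (Fin n)).powersetCard (m + 1),
        ENNReal.ofReal (σ ^ (m + 1)) := by
        apply Finset.sum_le_sum
        intro S hS
        have := prob_many n N d Q S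
        rw [(Finset.mem_powersetCard.1 hS).2, side_sq] at this
        exact this
    _ = ENNReal.ofReal ((n.choose (m + 1) : ℕ) * σ ^ (m + 1)) := by
        rw [Finset.sum_const, nsmul_eq_mul, ENNReal.ofReal_mul (by positivity),
            ENNReal.ofReal_natCast, Finset.card_powersetCard, Finset.card_univ, Fintype.card_fin]
    _ ≤ _ := by
        apply ENNReal.ofReal_le_ofReal
        have h1 : ((n.choose (m + 1) : ℕ) : ℝ) ≤ (n : ℝ) ^ (m + 1) / (m + 1).factorial :=
          Nat.choose_le_pow_div _ _
        have h2 := Real.pow_div_factorial_le_exp (3 * (n * σ)) (by positivity) (m + 1)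
        have h3 : Real.exp (m + 1) ≤ 3 ^ (m + 1) := by
          have : Real.exp (m + 1) = Real.exp 1 ^ (m + 1) := by
            rw [← Real.exp_nat_mul]; push_cast; ring_nf
          rw [this]
          gcongr
          exact Real.exp_one_lt_three.le
        rw [Real.exp_sub, le_div_iff₀ (by positivity)]
        calc ((n.choose (m + 1) : ℕ) : ℝ) * σ ^ (m + 1) * Real.exp (m + 1)
            ≤ ((n : ℝ) ^ (m + 1) / (m + 1).factorial) * σ ^ (m + 1) * 3 ^ (m + 1) := by gcongr
          _ = (3 * (n * σ)) ^ (m + 1) / (m + 1).factorial := by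
              rw [mul_pow, mul_pow]; ring
          _ ≤ _ := h2

open Classical in
/-- The good event has probability at least `1 - 1/n`. -/
lemma bad_bound (A B K n N d : ℕ) (hA : 1 ≤ A) (hB : B = 16 * A + 6) (hK : K = 48 * A + 6)
    (hn : 1 ≤ n)
    (hN1 : 4 ^ N ≤ n) (hN2 : n < 4 ^ (N + 1)) (hd : 16 ≤ 2 ^ d)
    (hd2 : 4 ^ d ≤ 4 * (A * (N + 1))) :
    PP n {x | ¬ ((∀ i a, x i a ∈ Set.Ico (0 : ℝ) 1) ∧ Function.Injective x ∧
      (∀ Q ∈ Finset.range (2 ^ N) ×ˢ Finset.range (2 ^ N),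
        (Finset.univ.filter fun i => clv d (cellB N (x i)) = Q).card ≤ K * (N + 1)) ∧
      (∀ l ∈ Finset.Ico 1 (N + 1), ∀ Q ∈ Finset.range (2 ^ N) ×ˢ Finset.range (2 ^ N),
        ((FF N l d Q).filter fun e => ∀ j, clv l (cellB N (x j)) ≠ e).card ≤
          B * (N + 1) / 4 ^ l))} ≤ ENNReal.ofReal (1 / n) := by
  set R := Finset.range (2 ^ N) ×ˢ Finset.range (2 ^ N) with hR
  have hRc : R.card = 4 ^ N := by
    rw [hR, Finset.card_product, Finset.card_range, ← mul_pow]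
    norm_num
  have hnR1 : (4 : ℝ) ^ N ≤ n := by exact_mod_cast hN1
  have hnR2 : (n : ℝ) ≤ 4 * 4 ^ N := by
    have : (n : ℝ) < 4 ^ (N + 1) := by exact_mod_cast hN2
    rw [pow_succ] at this
    linarith
  have hd2R : (4 : ℝ) ^ d ≤ 4 * (A * (N + 1)) := by exact_mod_cast hd2
  have h4N : (0 : ℝ) < 4 ^ N := by positivity
  set q : ℝ := Real.exp (-(6 * (N + 1))) with hq
  have b1 : ∀ Q, PP n {x | ¬ (Finset.univ.filter fun i => clv d (cellB N (x i)) = Q).card ≤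
      K * (N + 1)} ≤ ENNReal.ofReal q := by
    intro Q
    refine (many_event n N d _ Q).trans (ENNReal.ofReal_le_ofReal (Real.exp_le_exp.2 ?_))
    have h1 : (n : ℝ) * (4 ^ d / 4 ^ N) ≤ 16 * (A * (N + 1)) := by
      rw [← mul_div_assoc, div_le_iff₀ h4N]
      calc (n : ℝ) * 4 ^ d ≤ (4 * 4 ^ N) * (4 * (A * (N + 1))) := by gcongr
        _ = _ := by ring
    push_cast
    rw [hK]
    push_cast
    nlinarith
  have b2 : ∀ l ∈ Finset.Ico 1 (N + 1), ∀ Q,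
      PP n {x | ¬ ((FF N l d Q).filter fun e => ∀ j, clv l (cellB N (x j)) ≠ e).card ≤
          B * (N + 1) / 4 ^ l} ≤ ENNReal.ofReal q := by
    intro l hl Q
    rw [Finset.mem_Ico] at hl
    refine (emp_event n N l d _ (by omega) Q).trans (ENNReal.ofReal_le_ofReal ?_)
    set m := B * (N + 1) / 4 ^ l with hm
    have hm1 : (B : ℝ) * (N + 1) ≤ (m + 1) * 4 ^ l := by
      have : B * (N + 1) < (m + 1) * 4 ^ l := by
        rw [← Nat.div_lt_iff_lt_mul (by positivity)]
        omega
      exact_mod_cast this.le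
    have h1 : (B : ℝ) * (N + 1) ≤ n * ((m + 1) * (4 ^ l / 4 ^ N)) := by
      rw [← mul_div_assoc, ← mul_div_assoc, le_div_iff₀ h4N]
      calc (B : ℝ) * (N + 1) * 4 ^ N ≤ ((m + 1) * 4 ^ l) * n := by gcongr
        _ = _ := by ring
    have h2 : (2 : ℝ) ^ (FF N l d Q).card ≤ Real.exp (16 * (A * (N + 1))) := by
      have hc : ((FF N l d Q).card : ℝ) ≤ 16 * (A * (N + 1)) := by
        have : ((FF N l d Q).card : ℝ) ≤ 4 * 4 ^ d := by exact_mod_cast FF_card N l d hd Q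
        linarith
      calc (2 : ℝ) ^ (FF N l d Q).card ≤ Real.exp 1 ^ (FF N l d Q).card := by
            gcongr
            have := Real.add_one_le_exp (1 : ℝ)
            linarith
        _ = Real.exp ((FF N l d Q).card) := by rw [← Real.exp_nat_mul, mul_one]
        _ ≤ _ := Real.exp_le_exp.2 hc
    calc _ ≤ Real.exp (16 * (A * (N + 1))) * Real.exp (-(B * (N + 1))) := by
          gcongr
      _ = q := by
          rw [← Real.exp_add, hq, hB]
          push_cast
          ring_nf
  have hsub : {x : Fin n → EE | ¬ ((∀ i a, x i a ∈ Set.Ico (0 : ℝ) 1) ∧ Function.Injective x ∧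
      (∀ Q ∈ R, (Finset.univ.filter fun i => clv d (cellB N (x i)) = Q).card ≤ K * (N + 1)) ∧
      (∀ l ∈ Finset.Ico 1 (N + 1), ∀ Q ∈ R,
        ((FF N l d Q).filter fun e => ∀ j, clv l (cellB N (x j)) ≠ e).card ≤
          B * (N + 1) / 4 ^ l))} ⊆
      {x | ¬ ∀ i a, x i a ∈ Set.Ico (0 : ℝ) 1} ∪ ({x | ¬ Function.Injective x} ∪
      ((⋃ Q ∈ R, {x | ¬ (Finset.univ.filter fun i => clv d (cellB N (x i)) = Q).card ≤
        K * (N + 1)}) ∪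
      ⋃ l ∈ Finset.Ico 1 (N + 1), ⋃ Q ∈ R,
        {x | ¬ ((FF N l d Q).filter fun e => ∀ j, clv l (cellB N (x j)) ≠ e).card ≤
          B * (N + 1) / 4 ^ l})) := by
    intro x hx
    by_contra hcon
    apply hx
    simp only [Set.mem_union, Set.mem_iUnion, Set.mem_ofPred_eq, not_or, not_exists,
      not_not] at hcon
    exact ⟨hcon.1, hcon.2.1, hcon.2.2.1, hcon.2.2.2⟩
  refine (measure_mono hsub).trans ?_
  refine (measure_union_le _ _).trans ?_
  rw [prob_half, zero_add]
  refine (measure_union_le _ _).trans ?_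
  rw [prob_noninj, zero_add]
  refine (measure_union_le _ _).trans ?_
  have hq0 : 0 ≤ q := (Real.exp_pos _).le
  have s1 : PP n (⋃ Q ∈ R, {x | ¬ (Finset.univ.filter fun i => clv d (cellB N (x i)) = Q).card ≤
        K * (N + 1)}) ≤ ENNReal.ofReal (4 ^ N * q) := by
    refine (measure_biUnion_finset_le _ _).trans ((Finset.sum_le_sum fun Q _ => b1 Q).trans ?_)
    rw [Finset.sum_const, nsmul_eq_mul, hRc, ENNReal.ofReal_mul (by positivity)]
    apply le_of_eq
    congr 1
    rw [← ENNReal.ofReal_natCast]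
    push_cast
    rfl
  have s2 : PP n (⋃ l ∈ Finset.Ico 1 (N + 1), ⋃ Q ∈ R,
        {x | ¬ ((FF N l d Q).filter fun e => ∀ j, clv l (cellB N (x j)) ≠ e).card ≤
          B * (N + 1) / 4 ^ l}) ≤ ENNReal.ofReal (N * (4 ^ N * q)) := by
    refine (measure_biUnion_finset_le _ _).trans ((Finset.sum_le_sum
      (g := fun _ => ENNReal.ofReal (4 ^ N * q)) fun l hl => ?_).trans ?_)
    · refine (measure_biUnion_finset_le _ _).trans ((Finset.sum_le_sum fun Q _ => b2 l hl Q).trans ?_)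
      rw [Finset.sum_const, nsmul_eq_mul, hRc, ENNReal.ofReal_mul (by positivity)]
      apply le_of_eq
      congr 1
      rw [← ENNReal.ofReal_natCast]
      push_cast
      rfl
    · rw [Finset.sum_const, nsmul_eq_mul, Nat.card_Ico, Nat.add_sub_cancel,
        ← ENNReal.ofReal_natCast, ← ENNReal.ofReal_mul (by positivity)]
  refine (add_le_add s1 s2).trans ?_
  rw [← ENNReal.ofReal_add (by positivity) (by positivity)]
  apply ENNReal.ofReal_le_ofReal
  have e1 : (4 : ℝ) ^ (N + 1) ≤ Real.exp (2 * (N + 1)) := by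
    have h4 : (4 : ℝ) ≤ Real.exp 2 := by
      have h := Real.add_one_le_exp (1 : ℝ)
      have : Real.exp 2 = Real.exp 1 * Real.exp 1 := by rw [← Real.exp_add]; norm_num
      nlinarith
    calc (4 : ℝ) ^ (N + 1) ≤ Real.exp 2 ^ (N + 1) := by gcongr
      _ = _ := by rw [← Real.exp_nat_mul]; push_cast; ring_nf
  have e2 : ((N : ℝ) + 1) ≤ Real.exp (N + 1) := by
    have := Real.add_one_le_exp ((N : ℝ) + 1)
    linarith
  have hn0 : (0 : ℝ) < n := by exact_mod_cast hn
  rw [le_div_iff₀ hn0]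
  have e3 : (4 : ℝ) ^ N ≤ Real.exp (2 * (N + 1)) := by
    rw [pow_succ] at e1; linarith
  have e4 : (n : ℝ) ≤ Real.exp (2 * (N + 1)) := by
    rw [pow_succ] at e1; linarith
  calc (4 ^ N * q + N * (4 ^ N * q)) * n = ((N : ℝ) + 1) * 4 ^ N * n * q := by ring
    _ ≤ Real.exp (N + 1) * Real.exp (2 * (N + 1)) * Real.exp (2 * (N + 1)) * q := by gcongr
    _ = Real.exp (-(N + 1)) := by
        rw [hq, ← Real.exp_add, ← Real.exp_add, ← Real.exp_add]
        ring_nf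
    _ ≤ 1 := by
        rw [Real.exp_le_one_iff]
        have : (0 : ℝ) ≤ N := by positivity
        linarith

lemma meas_conn (α T : ℝ) (n : ℕ) (c : Fin n → ℕ) :
    MeasurableSet {x : Fin n → EE | sirConnected α T x c} := by
  have h : Measurable fun (x : Fin n → EE) (i j : Fin n) => sirEdge α T x c i j := by
    refine measurable_pi_lambda _ fun i => measurable_pi_lambda _ fun j => ?_
    have h2 : MeasurableSet {x : Fin n → EE |
        T * ∑ k ∈ Finset.univ.filter (fun k => k ≠ i ∧ c k = c i), dist (x k) (x j) ^ (-α) ≤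
          dist (x i) (x j) ^ (-α)} := by
      apply measurableSet_le
      · apply Measurable.const_mul
        apply Finset.measurable_sum
        intro k _
        exact ((measurable_pi_apply k).dist (measurable_pi_apply j)).pow_const _
      · exact ((measurable_pi_apply i).dist (measurable_pi_apply j)).pow_const _
    have h3 : MeasurableSet {x : Fin n → EE | sirEdge α T x c i j} :=
      (MeasurableSet.const (i ≠ j)).inter h2
    exact measurableSet_setOfPred.1 h3
  exact h (MeasurableSet.of_discrete
    (s := {r : Fin n → Fin n → Prop | ∀ i j, i ≠ j → Relation.TransGen r i j}))

lemma exists_meas (α T : ℝ) (n M : ℕ) (hM : 1 ≤ M) :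
    ∃ χ : (Fin n → EE) → (Fin n → ℕ), Measurable χ ∧
      (∀ x i, χ x i ∈ Finset.Icc 1 M) ∧
      ∀ x, (∃ c : Fin n → ℕ, (∀ i, c i ∈ Finset.Icc 1 M) ∧ sirConnected α T x c) →
        sirConnected α T x (χ x) := by
  classical
  obtain ⟨g, hg⟩ := exists_surjective_nat (Fin n → ℕ)
  let valid : (Fin n → ℕ) → Prop := fun c => ∀ i, c i ∈ Finset.Icc 1 M
  let ok : (Fin n → EE) → Prop := fun x => ∃ k, valid (g k) ∧ sirConnected α T x (g k)
  let p : ℕ → (Fin n → EE) → Prop := fun k x =>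
    (valid (g k) ∧ sirConnected α T x (g k)) ∨ ¬ ok x
  have h : ∀ x, ∃ k, p k x := by
    intro x
    by_cases hx : ok x
    · obtain ⟨k, hk⟩ := hx
      exact ⟨k, Or.inl hk⟩
    · exact ⟨0, Or.inr hx⟩
  have hm1 : ∀ k, MeasurableSet {x : Fin n → EE | valid (g k) ∧ sirConnected α T x (g k)} :=
    fun k => (MeasurableSet.const _).inter (meas_conn α T n (g k))
  have hok : MeasurableSet {x : Fin n → EE | ok x} := by
    have : {x : Fin n → EE | ok x} =
        ⋃ k, {x : Fin n → EE | valid (g k) ∧ sirConnected α T x (g k)} := by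
      ext x; simp [ok]
    rw [this]
    exact MeasurableSet.iUnion hm1
  have hp : ∀ k, MeasurableSet {x | p k x} := fun k => (hm1 k).union hok.compl
  let f : ℕ → (Fin n → EE) → (Fin n → ℕ) := fun k _ => if valid (g k) then g k else fun _ => 1
  refine ⟨fun x => f (Nat.find (h x)) x, ?_, ?_, ?_⟩
  · exact Measurable.find (f := f) (p := p) (fun k => measurable_const) hp h
  · intro x i
    simp only [f]
    split_ifs with hv
    · exact hv i
    · exact Finset.mem_Icc.2 ⟨le_rfl, hM⟩
  · rintro x ⟨c, hc1, hc2⟩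
    obtain ⟨k, rfl⟩ := hg c
    have hx : ok x := ⟨k, hc1, hc2⟩
    rcases Nat.find_spec (h x) with hs | hs
    · simp only [f]
      rw [if_pos hs.1]
      exact hs.2
    · exact absurd hx hs

lemma color_count (K B N : ℕ) :
    ∑ l ∈ Finset.range (N + 1), (if l = 0 then K * (N + 1) else B * (N + 1) / 4 ^ l * 49) * 4 ≤
      4 * (K + 49 * B) * (N + 1) := by
  rw [Finset.range_eq_Ico, Finset.sum_eq_sum_Ico_succ_bot (Nat.succ_pos N)]
  have h := Nat.geom_sum_Ico_le (b := 4) (by norm_num) (B * (N + 1)) (N + 1)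
  have h2 : ∑ l ∈ Finset.Ico (0 + 1) (N + 1),
      (if l = 0 then K * (N + 1) else B * (N + 1) / 4 ^ l * 49) * 4 =
      (∑ l ∈ Finset.Ico 1 (N + 1), B * (N + 1) / 4 ^ l) * 196 := by
    rw [Finset.sum_mul]
    apply Finset.sum_congr rfl
    intro l hl
    have : l ≠ 0 := by have := (Finset.mem_Ico.1 hl).1; omega
    rw [if_neg this]
    ring
  rw [h2, if_pos rfl]
  have h3 : B * (N + 1) / (4 - 1) ≤ B * (N + 1) := Nat.div_le_self _ _
  nlinarith

/-- For any path-loss exponent `α ≥ 2` and threshold `T > 0` there exist a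
constant `κ > 0` and measurable coloring maps `χ n` using at most `⌈κ·log n⌉` colors
(labelled `1, …, ⌈κ·log n⌉`; the `max` with `1` only handles the degenerate cases
`n ≤ 1` where `⌈κ·log n⌉ = 0`), such that for `n` i.i.d. uniform points on the unit square
the probability that the colored SIR digraph is connected tends to `1` as `n → ∞`. -/
theorem stmt_0 (α T : ℝ) (hα : 2 ≤ α) (hT : 0 < T) :
    ∃ κ : ℝ, 0 < κ ∧
      ∃ χ : (n : ℕ) → (Fin n → EuclideanSpace ℝ (Fin 2)) → (Fin n → ℕ),
        (∀ n, Measurable (χ n)) ∧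
        (∀ (n : ℕ) (x) (i), χ n x i ∈ Finset.Icc 1 (max 1 ⌈κ * Real.log n⌉₊)) ∧
        Tendsto
          (fun n : ℕ =>
            Measure.pi (fun _ : Fin n => volume.restrict unitSquare)
              {x | sirConnected α T x (χ n x)})
          atTop (nhds 1) := by
  obtain ⟨A, hA⟩ := exists_nat_ge (max 256 (2048 * T ^ (2 / α)))
  have hA1 : 256 ≤ A := by exact_mod_cast (le_max_left _ _).trans hA
  have hA2 : 2048 * T ^ (2 / α) ≤ A := (le_max_right _ _).trans hA
  set B := 16 * A + 6 with hB
  set K := 48 * A + 6 with hK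
  set κ : ℝ := 8 * (K + 49 * B) with hκ
  have hκ0 : 0 < κ := by
    have : (0 : ℝ) < K := by rw [hK]; positivity
    positivity
  refine ⟨κ, hκ0, ?_⟩
  choose χ hχ1 hχ2 hχ3 using fun n : ℕ =>
    exists_meas α T n (max 1 ⌈κ * Real.log n⌉₊) (le_max_left _ _)
  refine ⟨χ, hχ1, hχ2, ?_⟩
  have key : ∀ n : ℕ, 4 ≤ n → 1 - ENNReal.ofReal (1 / n) ≤
      Measure.pi (fun _ : Fin n => volume.restrict unitSquare)
        {x | sirConnected α T x (χ n x)} := by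
    intro n hn
    classical
    set N := Nat.log 4 n with hN
    have hN1 : 4 ^ N ≤ n := Nat.pow_log_le_self 4 (by omega)
    have hN2 : n < 4 ^ (N + 1) := Nat.lt_pow_succ_log_self (by norm_num) n
    have hNpos : 1 ≤ N := Nat.log_pos (by norm_num) hn
    set d := Nat.clog 4 (A * (N + 1)) with hd
    have hd1 : A * (N + 1) ≤ 4 ^ d := Nat.le_pow_clog (by norm_num) _
    have hAN : 256 ≤ A * (N + 1) := by nlinarith
    have hd2 : 4 ^ d ≤ 4 * (A * (N + 1)) := by
      have h1 : 4 ^ (d - 1) < A * (N + 1) :=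
        Nat.pow_pred_clog_lt_self (by norm_num) (by omega)
      have h2 : 4 ^ d ≤ 4 * 4 ^ (d - 1) := by
        rw [← pow_succ']
        exact Nat.pow_le_pow_right (by norm_num) (by omega)
      omega
    have hd16 : 16 ≤ 2 ^ d := by
      have h4 : (4 : ℕ) ^ d = 2 ^ d * 2 ^ d := by rw [← mul_pow]; norm_num
      by_contra hcon
      have h15 : 2 ^ d ≤ 15 := by omega
      have := Nat.mul_le_mul h15 h15
      omega
    have hbad := bad_bound A B K n N d (by omega) hB hK (by omega) hN1 hN2 hd16 hd2
    set bad := {x : Fin n → EE | ¬ ((∀ i a, x i a ∈ Set.Ico (0 : ℝ) 1) ∧ Function.Injective x ∧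
      (∀ Q ∈ Finset.range (2 ^ N) ×ˢ Finset.range (2 ^ N),
        (Finset.univ.filter fun i => clv d (cellB N (x i)) = Q).card ≤ K * (N + 1)) ∧
      (∀ l ∈ Finset.Ico 1 (N + 1), ∀ Q ∈ Finset.range (2 ^ N) ×ˢ Finset.range (2 ^ N),
        ((FF N l d Q).filter fun e => ∀ j, clv l (cellB N (x j)) ≠ e).card ≤
          B * (N + 1) / 4 ^ l))} with hbadd
    have hM : 4 * (K + 49 * B) * (N + 1) ≤ max 1 ⌈κ * Real.log n⌉₊ := by
      refine le_trans ?_ (le_max_right _ _)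
      have hlog : (N : ℝ) ≤ Real.log n := by
        calc (N : ℝ) = N * 1 := (mul_one _).symm
          _ ≤ N * Real.log 4 := by
              gcongr
              rw [Real.le_log_iff_exp_le (by norm_num)]
              linarith [Real.exp_one_lt_three]
          _ = Real.log (4 ^ N) := by rw [Real.log_pow]
          _ ≤ Real.log n := by
              apply Real.log_le_log (by positivity)
              exact_mod_cast hN1
      have h1 : ((4 * (K + 49 * B) * (N + 1) : ℕ) : ℝ) ≤ κ * Real.log n := by
        have hN' : (1 : ℝ) ≤ N := by exact_mod_cast hNpos
        calc ((4 * (K + 49 * B) * (N + 1) : ℕ) : ℝ) = 4 * (K + 49 * B) * (N + 1) := by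
              push_cast; ring
          _ ≤ 4 * (K + 49 * B) * (2 * Real.log n) := by
              gcongr
              linarith
          _ = κ * Real.log n := by rw [hκ]; ring
      exact_mod_cast h1.trans (Nat.le_ceil _)
    have hcov : (Set.univ : Set (Fin n → EE)) ⊆ {x | sirConnected α T x (χ n x)} ∪ bad := by
      intro x _
      by_cases hx : x ∈ bad
      · exact Or.inr hx
      · left
        rw [hbadd, Set.mem_ofPred_eq, not_not] at hx
        obtain ⟨g1, g2, g3, g4⟩ := hx
        obtain ⟨c, hc1, hc2⟩ := det_main α T hα hT n N d x g1 g2 hd16 (by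
          have : ((A * (N + 1) : ℕ) : ℝ) ≤ 4 ^ d := by exact_mod_cast hd1
          push_cast at this
          refine le_trans ?_ this
          gcongr) (K * (N + 1)) (fun l => B * (N + 1) / 4 ^ l) g3 g4
        apply hχ3 n x
        refine ⟨c, fun i => ?_, hc2⟩
        have := Finset.mem_Icc.1 (hc1 i)
        exact Finset.mem_Icc.2 ⟨this.1, this.2.trans ((color_count K B N).trans hM)⟩
    rw [tsub_le_iff_right]
    calc (1 : ENNReal) = PP n Set.univ := measure_univ.symm
      _ ≤ PP n ({x | sirConnected α T x (χ n x)} ∪ bad) := measure_mono hcov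
      _ ≤ _ := (measure_union_le _ _).trans (add_le_add le_rfl hbad)
  refine tendsto_of_tendsto_of_tendsto_of_le_of_le'
    (g := fun n : ℕ => 1 - ENNReal.ofReal (1 / n)) (h := fun _ => 1) ?_ tendsto_const_nhds ?_ ?_
  · have h1 : Tendsto (fun n : ℕ => ENNReal.ofReal (1 / (n : ℝ))) atTop (nhds 0) := by
      have := ENNReal.tendsto_ofReal tendsto_one_div_atTop_nhds_zero_nat
      simpa using this
    have h2 := ENNReal.Tendsto.sub (tendsto_const_nhds (x := (1 : ENNReal)) (f := atTop)) h1
      (Or.inl ENNReal.one_ne_top)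
    simpa using h2
  · filter_upwards [eventually_ge_atTop 4] with n hn using key n hn
  · exact Eventually.of_forall fun n => prob_le_one
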